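/- arXiv:2309.04240 — 3 statements merged into one kernel-verified Lean document; each statement's English description precedes it below -/
import Mathlib

section
/- Let β ∈ B₃ and suppose that the (2,1)-entry of the matrix ρ₃(β) is the zero Laurent polynomial. Then β belongs to the subgroup of B₃ generated by σ₁ and (σ₁σ₂)³. -/
open Matrix LaurentPolynomial
open scoped MatrixGroups

noncomputable section

/-- The braid relation σ₁σ₂σ₁ = σ₂σ₁σ₂ as a relator in the free group on two generators. -/
def braidRel : Set (FreeGroup (Fin 2)) :=
  {FreeGroup.of 0 * FreeGroup.of 1 * FreeGroup.of 0 *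
    (FreeGroup.of 1 * FreeGroup.of 0 * FreeGroup.of 1)⁻¹}

/-- The braid group B₃ on three strands. -/
abbrev B3 : Type := PresentedGroup braidRel

/-- The first Artin generator σ₁ of B₃. -/
def σ₁ : B3 := PresentedGroup.of 0

/-- The second Artin generator σ₂ of B₃. -/
def σ₂ : B3 := PresentedGroup.of 1
/-- The ring ℤ[t,t⁻¹] of integer Laurent polynomials. -/
abbrev Laur := LaurentPolynomial ℤ

section Garside

variable {G : Type*} [Group G] {a b : G}

theorem garside_mul_left (h : a * b * a = b * a * b) : a * b * a * a = b * (a * b * a) := by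
  calc a * b * a * a = b * a * b * a := by rw [h]
    _ = b * (a * b * a) := by group

theorem garside_mul_right (h : a * b * a = b * a * b) : a * b * a * b = a * (a * b * a) := by
  calc a * b * a * b = a * (b * a * b) := by group
    _ = a * (a * b * a) := by rw [h]

theorem garside_sq (h : a * b * a = b * a * b) : a * b * a * (a * b * a) = (a * b) ^ 3 := by
  calc a * b * a * (a * b * a) = a * b * a * (b * a * b) := by rw [← h]
    _ = (a * b) ^ 3 := by simp only [pow_succ, pow_zero, one_mul, mul_assoc]

theorem commute_full_twist_left (h : a * b * a = b * a * b) : Commute ((a * b) ^ 3) a := by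
  rw [← garside_sq h]
  change _ = _
  rw [mul_assoc, garside_mul_left h, ← mul_assoc, garside_mul_right h, mul_assoc]

theorem commute_full_twist_right (h : a * b * a = b * a * b) : Commute ((a * b) ^ 3) b := by
  rw [← garside_sq h]
  change _ = _
  rw [mul_assoc, garside_mul_right h, ← mul_assoc, garside_mul_left h, mul_assoc]

theorem mul_mul_garside (h : a * b * a = b * a * b) :
    a * b * (a * b * a) = b⁻¹ * (a * b) ^ 3 := by
  rw [eq_inv_mul_iff_mul_eq, ← garside_sq h]
  calc b * (a * b * (a * b * a)) = b * a * b * (a * b * a) := by group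
    _ = _ := by rw [h]

end Garside

theorem braid_relation : σ₁ * σ₂ * σ₁ = σ₂ * σ₁ * σ₂ := by
  have h : PresentedGroup.mk braidRel _ = 1 :=
    PresentedGroup.one_of_mem (rels := braidRel) (Set.mem_singleton _)
  rw [map_mul, map_inv, mul_inv_eq_one] at h
  simpa only [map_mul] using! h

theorem commute_full_twist (x : B3) : Commute ((σ₁ * σ₂) ^ 3) x := by
  have hx : x ∈ Subgroup.closure (Set.range (PresentedGroup.of (rels := braidRel))) := by
    rw [PresentedGroup.closure_range_of]
    trivial
  induction hx using Subgroup.closure_induction with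
  | mem x hx =>
    obtain ⟨i, rfl⟩ := hx
    fin_cases i
    · exact commute_full_twist_left braid_relation
    · exact commute_full_twist_right braid_relation
  | one => exact Commute.one_right _
  | mul x y _ _ hx hy => exact hx.mul_right hy
  | inv x _ hx => exact hx.inv_right

/-- Induction principle for `B₃` along left multiplication by `σ₁σ₂` and `σ₁σ₂σ₁`, which generate
`B₃` as a monoid up to the powers of the full twist. -/
theorem B3.induction_left {p : B3 → Prop} (one : p 1)
    (twist : ∀ x, p x → p (((σ₁ * σ₂) ^ 3)⁻¹ * x))
    (rot : ∀ x, p x → p (σ₁ * σ₂ * x))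
    (garside : ∀ x, p x → p (σ₁ * σ₂ * σ₁ * x)) (x : B3) : p x := by
  have rot_inv (x) (hx : p x) : p ((σ₁ * σ₂)⁻¹ * x) := by
    convert twist _ (rot _ (rot _ hx)) using 1
    simp only [pow_succ, pow_zero]
    group
  have garside_inv (x) (hx : p x) : p ((σ₁ * σ₂ * σ₁)⁻¹ * x) := by
    convert twist _ (garside _ hx) using 1
    rw [← garside_sq braid_relation]
    group
  have hx : x ∈ Subgroup.closure (Set.range (PresentedGroup.of (rels := braidRel))) := by
    rw [PresentedGroup.closure_range_of]
    trivial
  induction hx using Subgroup.closure_induction_left with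
  | one => exact one
  | mul_left x hx y _ hy =>
    obtain ⟨i, rfl⟩ := hx
    fin_cases i
    · change p (σ₁ * y)
      convert rot_inv _ (garside _ hy) using 1
      group
    · change p (σ₂ * y)
      convert garside_inv _ (rot _ (rot _ hy)) using 1
      group
  | inv_mul_cancel x hx y _ hy =>
    obtain ⟨i, rfl⟩ := hx
    fin_cases i
    · change p (σ₁⁻¹ * y)
      convert garside_inv _ (rot _ hy) using 1
      group
    · change p (σ₂⁻¹ * y)
      convert rot_inv _ (rot_inv _ (garside _ hy)) using 1
      group

/-- Normal form modulo the subgroup generated by `σ₁` and the full twist: a positive word in `σ₁`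
and `σ₂⁻¹`, possibly flanked by the half twist `σ₁σ₂σ₁`. -/
theorem exists_normal_form (x : B3) :
    ∃ p ∈ ({1, σ₁ * σ₂ * σ₁} : Set B3), ∃ w ∈ Submonoid.closure {σ₁, σ₂⁻¹},
      ∃ q ∈ ({1, σ₁ * σ₂ * σ₁} : Set B3), ∃ h ∈ Subgroup.closure {σ₁, (σ₁ * σ₂) ^ 3},
        x = p * w * q * h := by
  have hσ : σ₁ ∈ Subgroup.closure {σ₁, (σ₁ * σ₂) ^ 3} := Subgroup.subset_closure (by simp)
  have hc : (σ₁ * σ₂) ^ 3 ∈ Subgroup.closure {σ₁, (σ₁ * σ₂) ^ 3} :=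
    Subgroup.subset_closure (by simp)
  have hL : σ₂⁻¹ ∈ Submonoid.closure {σ₁, σ₂⁻¹} := Submonoid.subset_closure (by simp)
  have one_mem_set : (1 : B3) ∈ ({1, σ₁ * σ₂ * σ₁} : Set B3) := by simp
  have garside_mem : σ₁ * σ₂ * σ₁ ∈ ({1, σ₁ * σ₂ * σ₁} : Set B3) := by simp
  induction x using B3.induction_left with
  | one => exact ⟨1, one_mem_set, 1, one_mem _, 1, one_mem_set, 1, one_mem _, by simp⟩
  | twist x hx =>
    obtain ⟨p, hp, w, hw, q, hq, h, hh, rfl⟩ := hx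
    exact ⟨p, hp, w, hw, q, hq, _, mul_mem (inv_mem hc) hh,
      (commute_full_twist (p * w * q)).inv_left.left_comm h⟩
  | garside x hx =>
    obtain ⟨p, rfl | rfl, w, hw, q, hq, h, hh, rfl⟩ := hx
    · exact ⟨_, garside_mem, w, hw, q, hq, h, hh, by group⟩
    · refine ⟨1, one_mem_set, w, hw, q, hq, _, mul_mem hc hh, ?_⟩
      rw [one_mul, ← (commute_full_twist (w * q)).left_comm, ← garside_sq braid_relation]
      group
  | rot x hx =>
    obtain ⟨p, rfl | rfl, w, hw, q, hq, h, hh, rfl⟩ := hx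
    · induction hw using Submonoid.closure_induction_left with
      | one =>
        obtain rfl | rfl := hq
        · exact ⟨_, garside_mem, 1, one_mem _, 1, one_mem_set, _, mul_mem (inv_mem hσ) hh, by group⟩
        · refine ⟨1, one_mem_set, _, hL, 1, one_mem_set, _, mul_mem hc hh, ?_⟩
          simp only [one_mul, mul_one]
          rw [← mul_assoc σ₂⁻¹, ← mul_mul_garside braid_relation]
          group
      | mul_left y hy w hw _ =>
        obtain rfl | rfl := hy
        · exact ⟨_, garside_mem, w, hw, q, hq, h, hh, by group⟩
        · exact ⟨1, one_mem_set, σ₁ * w, mul_mem (Submonoid.subset_closure (by simp)) hw, q, hq, h, hh,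
            by group⟩
    · refine ⟨1, one_mem_set, _, mul_mem hL hw, q, hq, _, mul_mem hc hh, ?_⟩
      rw [one_mul, mul_assoc σ₂⁻¹, mul_assoc σ₂⁻¹, ← (commute_full_twist (w * q)).left_comm,
        ← mul_assoc σ₂⁻¹, ← mul_mul_garside braid_relation]
      group

section Specialization

variable (M : B3 →* Matrix (Fin 2) (Fin 2) ℤ)

/-- The elements of `B₃` which an integral representation sends to upper triangular matrices. -/
def upperTriangular : Subgroup B3 where
  carrier := {x | M x 1 0 = 0}
  one_mem' := by simp
  mul_mem' := by
    intro x y hx hy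
    simp_all [Matrix.mul_apply]
  inv_mem' := by
    intro x hx
    have h : M x⁻¹ * M x = 1 := by rw [← map_mul, inv_mul_cancel, map_one]
    have h₁ := congr_fun₂ h 1 0
    have h₀ := congr_fun₂ h 0 0
    simp only [Set.mem_ofPred_eq, Matrix.mul_apply, Fin.sum_univ_two] at hx h₀ h₁ ⊢
    rw [hx] at h₀ h₁
    have hne : M x 0 0 ≠ 0 := fun h => by simp [h] at h₀
    simpa [hne] using h₁

variable {M}

theorem map_σ₂_inv (h₂ : M σ₂ = !![1, 0; -1, 1]) : M σ₂⁻¹ = !![1, 0; 1, 1] := by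
  have h : M σ₂⁻¹ * M σ₂ = 1 := by rw [← map_mul, inv_mul_cancel, map_one]
  have h' : M σ₂ * !![1, 0; 1, 1] = 1 := by rw [h₂]; decide
  exact left_inv_eq_right_inv h h'

theorem closure_le_upperTriangular (h₁ : M σ₁ = !![1, 1; 0, 1]) (h₂ : M σ₂ = !![1, 0; -1, 1]) :
    Subgroup.closure {σ₁, (σ₁ * σ₂) ^ 3} ≤ upperTriangular M := by
  rw [Subgroup.closure_le]
  rintro x (rfl | rfl)
  · change M σ₁ 1 0 = 0
    simp [h₁]
  · change M ((σ₁ * σ₂) ^ 3) 1 0 = 0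
    rw [map_pow, map_mul, h₁, h₂]
    decide

theorem map_garside (h₁ : M σ₁ = !![1, 1; 0, 1]) (h₂ : M σ₂ = !![1, 0; -1, 1]) :
    M (σ₁ * σ₂ * σ₁) = !![0, 1; -1, 0] := by
  rw [map_mul, map_mul, h₁, h₂]
  decide

theorem positive_word_fst_col (h₁ : M σ₁ = !![1, 1; 0, 1]) (h₂ : M σ₂ = !![1, 0; -1, 1])
    {w : B3} (hw : w ∈ Submonoid.closure {σ₁, σ₂⁻¹}) :
    0 < M w 0 0 ∧ 0 ≤ M w 1 0 ∧
      (M w 1 0 = 0 → w ∈ Subgroup.closure {σ₁, (σ₁ * σ₂) ^ 3}) := by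
  induction hw using Submonoid.closure_induction_left with
  | one => simp [one_mem]
  | mul_left y hy w _ ih =>
    obtain ⟨ha, hb, hw⟩ := ih
    obtain rfl | rfl := hy
    · simp only [map_mul, h₁, Matrix.mul_apply, Fin.sum_univ_two, Matrix.of_apply,
        Matrix.cons_val', Matrix.cons_val_zero, Matrix.cons_val_one, Matrix.cons_val_fin_one]
      exact ⟨by lia, by lia, fun h =>
        mul_mem (Subgroup.subset_closure (by simp)) (hw (by lia))⟩
    · simp only [map_mul, map_σ₂_inv h₂, Matrix.mul_apply, Fin.sum_univ_two, Matrix.of_apply,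
        Matrix.cons_val', Matrix.cons_val_zero, Matrix.cons_val_one, Matrix.cons_val_fin_one]
      exact ⟨by lia, by lia, fun h => by lia⟩

theorem positive_word_snd_col (h₁ : M σ₁ = !![1, 1; 0, 1]) (h₂ : M σ₂ = !![1, 0; -1, 1])
    {w : B3} (hw : w ∈ Submonoid.closure {σ₁, σ₂⁻¹}) :
    0 < M w 1 1 ∧ 0 ≤ M w 0 1 ∧ (M w 0 1 = 0 →
      σ₁ * σ₂ * σ₁ * w * (σ₁ * σ₂ * σ₁) ∈ Subgroup.closure {σ₁, (σ₁ * σ₂) ^ 3}) := by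
  induction hw using Submonoid.closure_induction_left with
  | one =>
    refine ⟨by simp, by simp, fun _ => ?_⟩
    rw [mul_one, garside_sq braid_relation]
    exact Subgroup.subset_closure (by simp)
  | mul_left y hy w _ ih =>
    obtain ⟨ha, hb, hw⟩ := ih
    obtain rfl | rfl := hy
    · simp only [map_mul, h₁, Matrix.mul_apply, Fin.sum_univ_two, Matrix.of_apply,
        Matrix.cons_val', Matrix.cons_val_zero, Matrix.cons_val_one, Matrix.cons_val_fin_one]
      exact ⟨by lia, by lia, fun h => by lia⟩
    · simp only [map_mul, map_σ₂_inv h₂, Matrix.mul_apply, Fin.sum_univ_two, Matrix.of_apply,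
        Matrix.cons_val', Matrix.cons_val_zero, Matrix.cons_val_one, Matrix.cons_val_fin_one]
      refine ⟨by lia, by lia, fun h => ?_⟩
      have hσ : σ₁⁻¹ ∈ Subgroup.closure {σ₁, (σ₁ * σ₂) ^ 3} :=
        inv_mem (Subgroup.subset_closure (by simp))
      convert mul_mem hσ (hw (by lia)) using 1
      simp only [← mul_assoc]
      rw [mul_left_inj, mul_left_inj, mul_left_inj, mul_left_inj, mul_inv_eq_iff_eq_mul]
      have h := garside_mul_right braid_relation
      calc σ₁ * σ₂ * σ₁ = σ₁⁻¹ * (σ₁ * (σ₁ * σ₂ * σ₁)) := by group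
        _ = σ₁⁻¹ * σ₁ * σ₂ * σ₁ * σ₂ := by rw [← h]; group

/-- The braids whose Burau matrix is upper triangular at `t = -1` are those in the subgroup
generated by `σ₁` and the full twist. -/
theorem upperTriangular_le_closure (h₁ : M σ₁ = !![1, 1; 0, 1]) (h₂ : M σ₂ = !![1, 0; -1, 1]) :
    upperTriangular M ≤ Subgroup.closure {σ₁, (σ₁ * σ₂) ^ 3} := by
  intro x hx
  obtain ⟨p, hp, w, hw, q, hq, h, hh, rfl⟩ := exists_normal_form x
  refine mul_mem ?_ hh
  rw [Subgroup.mul_mem_cancel_right _ (closure_le_upperTriangular h₁ h₂ hh)] at hx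
  change M (p * w * q) 1 0 = 0 at hx
  obtain ⟨ha, -, hw₁⟩ := positive_word_fst_col h₁ h₂ hw
  obtain ⟨hb, -, hw₂⟩ := positive_word_snd_col h₁ h₂ hw
  have hg := map_garside h₁ h₂
  obtain rfl | rfl := hp <;> obtain rfl | rfl := hq
  · simp only [one_mul, mul_one] at hx ⊢
    exact hw₁ hx
  · rw [one_mul, map_mul, hg] at hx
    simp [Matrix.mul_apply] at hx
    lia
  · rw [mul_one, map_mul, hg] at hx
    simp [Matrix.mul_apply] at hx
    lia
  · rw [map_mul, map_mul, hg] at hx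
    simp [Matrix.mul_apply] at hx
    exact hw₂ (by simpa [Matrix.vecMul, dotProduct] using hx)

end Specialization

/-- **Lemma (Lemma 1).** If the (2,1)-entry of the Burau matrix ρ₃(β) is the zero Laurent
polynomial, then β belongs to the subgroup of B₃ generated by σ₁ and (σ₁σ₂)³.
Here ρ₃ : B₃ → GL(2, ℤ[t,t⁻¹]) is the reduced Burau representation, determined by
σ₁ ↦ [[-t,1],[0,1]] and σ₂ ↦ [[1,0],[t,-t]] (the variable t is `T 1`). -/
theorem mem_closure_of_burau_lower_left_eq_zero
    (ρ : B3 →* GL (Fin 2) Laur)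
    (hρ₁ : (ρ σ₁ : Matrix (Fin 2) (Fin 2) Laur) = !![-T 1, 1; 0, 1])
    (hρ₂ : (ρ σ₂ : Matrix (Fin 2) (Fin 2) Laur) = !![1, 0; T 1, -T 1])
    (β : B3) (hβ : (ρ β : Matrix (Fin 2) (Fin 2) Laur) 1 0 = 0) :
    β ∈ Subgroup.closure {σ₁, (σ₁ * σ₂) ^ 3} := by
  let f : Laur →+* ℤ := LaurentPolynomial.eval₂ (RingHom.id ℤ) (-1)
  let M : B3 →* Matrix (Fin 2) (Fin 2) ℤ :=
    (f.mapMatrix (m := Fin 2)).toMonoidHom.comp ((Units.coeHom _).comp ρ)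
  have hM (x : B3) : M x = (ρ x : Matrix (Fin 2) (Fin 2) Laur).map f := rfl
  have hf : f (T 1) = -1 := by simp [f]
  have h₁ : M σ₁ = !![1, 1; 0, 1] := by
    rw [hM, hρ₁]
    ext i j
    fin_cases i <;> fin_cases j <;> simp [hf]
  have h₂ : M σ₂ = !![1, 0; -1, 1] := by
    rw [hM, hρ₂]
    ext i j
    fin_cases i <;> fin_cases j <;> simp [hf]
  apply upperTriangular_le_closure h₁ h₂
  change M β 1 0 = 0
  rw [hM, Matrix.map_apply, hβ, map_zero]
end
end

section
/- For every root of unity ζ ∈ ℂ, the specialized Burau representation ρ₃^{t₀} at t₀ = −ζ is not faithful. -/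
open Matrix LaurentPolynomial
open scoped MatrixGroups

noncomputable section

/-- The exponent-sum homomorphism of B₃, sending both Artin generators to `1`. -/
def exponentSum : B3 →* Multiplicative ℤ :=
  PresentedGroup.toGroup (f := fun _ : Fin 2 => Multiplicative.ofAdd (1 : ℤ)) (by
    rintro r rfl
    simp)

theorem exponentSum_σ₁ : exponentSum σ₁ = Multiplicative.ofAdd 1 :=
  PresentedGroup.toGroup.of _

theorem exponentSum_σ₂ : exponentSum σ₂ = Multiplicative.ofAdd 1 :=
  PresentedGroup.toGroup.of _

theorem σ₁_pow_ne_one {n : ℕ} (hn : 0 < n) : σ₁ ^ n ≠ 1 := by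
  intro h
  have h' := congrArg (fun g => (exponentSum g).toAdd) h
  simp [exponentSum_σ₁] at h'
  omega

theorem σ₁_mul_σ₂_pow_ne_one {n : ℕ} (hn : 0 < n) : (σ₁ * σ₂) ^ n ≠ 1 := by
  intro h
  have h' := congrArg (fun g => (exponentSum g).toAdd) h
  simp [exponentSum_σ₁, exponentSum_σ₂] at h'
  omega

theorem upperTriangular_pow {R : Type*} [CommRing R] (a : R) (n : ℕ) :
    (!![a, 1; 0, 1] : Matrix (Fin 2) (Fin 2) R) ^ n =
      !![a ^ n, ∑ i ∈ Finset.range n, a ^ i; 0, 1] := by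
  induction n with
  | zero => simp [Matrix.one_fin_two]
  | succ n ih =>
    rw [pow_succ, ih, Matrix.mul_fin_two, Finset.sum_range_succ]
    simp [pow_succ, add_comm]

theorem upperTriangular_pow_eq_one {K : Type*} [Field K] {a : K} (ha : a ≠ 1) {n : ℕ}
    (hn : a ^ n = 1) : (!![a, 1; 0, 1] : Matrix (Fin 2) (Fin 2) K) ^ n = 1 := by
  rw [upperTriangular_pow, geom_sum_eq ha, hn, sub_self, zero_div, Matrix.one_fin_two]

/-- **Roots of unity.** For every root of unity ζ ∈ ℂ, the Burau representation
specialized at t₀ = -ζ is not faithful. -/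
theorem burau_not_faithful_at_root_of_unity (ζ : ℂ) (hζ : ∃ n : ℕ, 0 < n ∧ ζ ^ n = 1)
    (t₀ : ℂ) (ht₀ : t₀ = -ζ)
    (ρ : B3 →* GL (Fin 2) ℂ)
    (hρ₁ : (ρ σ₁ : Matrix (Fin 2) (Fin 2) ℂ) = !![-t₀, 1; 0, 1])
    (hρ₂ : (ρ σ₂ : Matrix (Fin 2) (Fin 2) ℂ) = !![1, 0; t₀, -t₀]) :
    ¬ Function.Injective ρ := by
  obtain ⟨n, hn, hζn⟩ := hζ
  subst ht₀
  rw [neg_neg] at hρ₁ hρ₂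
  intro hinj
  rw [injective_iff_map_eq_one] at hinj
  by_cases h1 : ζ = 1
  · subst h1
    refine σ₁_mul_σ₂_pow_ne_one (n := 6) (by norm_num) (hinj _ (Units.ext ?_))
    rw [map_pow, map_mul, Units.val_pow_eq_pow_val, Units.val_mul, hρ₁, hρ₂, Units.val_one]
    simp [pow_succ, Matrix.one_fin_two]
  · refine σ₁_pow_ne_one hn (hinj _ (Units.ext ?_))
    rw [map_pow, Units.val_pow_eq_pow_val, hρ₁, Units.val_one,
      upperTriangular_pow_eq_one h1 hζn]
end
end

section
/- For every real number t₀ < 0 with t₀ ≠ −1, the specialized Burau representation ρ₃^{t₀} : B₃ → GL(2, ℂ) is faithful. -/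
open Matrix LaurentPolynomial
open scoped MatrixGroups

noncomputable section

/-- In a group generated by `a`, `b` with `a ^ 2 = b ^ 3`, every element is, up to a power of the
central element `a ^ 2`, a positive word in `a * b` and `a * b ^ 2`, preceded by a power of `b` and
followed by a power of `a`. -/
theorem exists_normal_form_s15 {G : Type*} [Group G] {a b : G} (hab : a ^ 2 = b ^ 3)
    (hgen : Subgroup.closure {a, b} = ⊤) (g : G) :
    ∃ k : ℤ, ∃ i < 3, ∃ j < 2, ∃ w ∈ Submonoid.closure {a * b, a * b ^ 2},
      g = (a ^ 2) ^ k * (b ^ i * w * a ^ j) := by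
  have hza (k : ℤ) (h : G) : a * ((a ^ 2) ^ k * h) = (a ^ 2) ^ k * (a * h) := by
    simp only [← mul_assoc, (((Commute.refl a).pow_right 2).zpow_right k).eq]
  have hzb (k : ℤ) (h : G) : b * ((a ^ 2) ^ k * h) = (a ^ 2) ^ k * (b * h) := by
    simp only [hab, ← mul_assoc, (((Commute.refl b).pow_right 3).zpow_right k).eq]
  set T : Set G := {g | ∃ k : ℤ, ∃ i < 3, ∃ j < 2,
    ∃ w ∈ Submonoid.closure {a * b, a * b ^ 2}, g = (a ^ 2) ^ k * (b ^ i * w * a ^ j)}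
  have hz (n : ℤ) {h : G} (hh : h ∈ T) : (a ^ 2) ^ n * h ∈ T := by
    obtain ⟨k, i, hi, j, hj, w, hw, rfl⟩ := hh
    exact ⟨n + k, i, hi, j, hj, w, hw, by rw [_root_.zpow_add, mul_assoc (_ ^ n)]⟩
  have hb {h : G} (hh : h ∈ T) : b * h ∈ T := by
    obtain ⟨k, i, hi, j, hj, w, hw, rfl⟩ := hh
    rw [hzb]
    refine hz k ?_
    obtain hi' | rfl : i + 1 < 3 ∨ i = 2 := by omega
    · exact ⟨0, i + 1, hi', j, hj, w, hw, by simp only [zpow_zero, one_mul, pow_succ', mul_assoc]⟩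
    · exact ⟨1, 0, by simp, j, hj, w, hw, by
        simp only [zpow_one, hab, pow_zero, one_mul, pow_succ', mul_assoc, mul_one]⟩
  have ha {h : G} (hh : h ∈ T) : a * h ∈ T := by
    obtain ⟨k, i, hi, j, hj, w, hw, rfl⟩ := hh
    rw [hza]
    refine hz k ?_
    obtain rfl | hi0 := Nat.eq_zero_or_pos i
    · induction hw using Submonoid.closure_induction_left with
      | one =>
        obtain rfl | rfl : j = 0 ∨ j = 1 := by omega
        · exact ⟨0, 0, by simp, 1, by simp, 1, one_mem _, by simp⟩
        · exact ⟨1, 0, by simp, 0, by simp, 1, one_mem _, by simp [pow_two]⟩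
      | mul_left x hx w hw _ =>
        obtain rfl | rfl := hx
        · exact ⟨1, 1, by simp, j, hj, w, hw, by simp [pow_succ, mul_assoc]⟩
        · exact ⟨1, 2, by simp, j, hj, w, hw, by simp [pow_succ, mul_assoc]⟩
    · refine ⟨0, 0, by simp, j, hj, a * b ^ i * w, mul_mem (Submonoid.subset_closure ?_) hw,
        by simp [mul_assoc]⟩
      obtain rfl | rfl : i = 1 ∨ i = 2 := by omega
      · simp
      · simp
  have key : g ∈ T := by
    have hg : g ∈ Subgroup.closure {a, b} := hgen ▸ Subgroup.mem_top g
    induction hg using Subgroup.closure_induction_left with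
    | one => exact ⟨0, 0, by simp, 0, by simp, 1, one_mem _, by simp⟩
    | mul_left x hx y _ ih =>
      obtain rfl | rfl := hx
      · exact ha ih
      · exact hb ih
    | inv_mul_cancel x hx y _ ih =>
      obtain rfl | rfl := hx
      · convert hz (-1) (ha ih) using 1
        simp [pow_two, mul_assoc]
      · convert hz (-1) (hb (hb ih)) using 1
        simp [hab, pow_succ, mul_assoc]
  exact key

theorem half_twist_sq : (σ₁ * σ₂ * σ₁) ^ 2 = (σ₁ * σ₂) ^ 3 := by
  calc (σ₁ * σ₂ * σ₁) ^ 2 = σ₁ * σ₂ * σ₁ * (σ₁ * σ₂ * σ₁) := pow_two _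
    _ = σ₁ * σ₂ * σ₁ * (σ₂ * σ₁ * σ₂) := by rw [← braid_relation]
    _ = (σ₁ * σ₂) ^ 3 := by simp only [pow_succ, pow_zero, one_mul, mul_assoc]

theorem closure_half_twist : Subgroup.closure {σ₁ * σ₂ * σ₁, σ₁ * σ₂} = ⊤ := by
  rw [eq_top_iff, ← PresentedGroup.closure_range_of, Subgroup.closure_le]
  have ha : σ₁ * σ₂ * σ₁ ∈ Subgroup.closure {σ₁ * σ₂ * σ₁, σ₁ * σ₂} :=
    Subgroup.subset_closure (by simp)
  have hb : σ₁ * σ₂ ∈ Subgroup.closure {σ₁ * σ₂ * σ₁, σ₁ * σ₂} :=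
    Subgroup.subset_closure (by simp)
  have h₁ : σ₁ ∈ Subgroup.closure {σ₁ * σ₂ * σ₁, σ₁ * σ₂} := by
    simpa [mul_assoc] using mul_mem (inv_mem hb) ha
  rintro _ ⟨i, rfl⟩
  fin_cases i
  · exact h₁
  · exact ((Subgroup.closure _).mul_mem_cancel_left h₁).mp hb

/-- Positive words in the images of `a * b` and `a * b ^ 2`, where `a` and `b` are represented by
the matrices below, are nonzero multiples of matrices with positive diagonal and nonpositive
off-diagonal entries, and only the empty word is diagonal. -/
theorem exists_sign_pattern {G : Type*} [Group G] (ρ : G →* GL (Fin 2) ℂ) {a b : G} {s : ℝ}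
    (hs : 0 < s) (ha : (ρ a : Matrix (Fin 2) (Fin 2) ℂ) = !![0, (s : ℂ); -(s : ℂ) ^ 2, 0])
    (hb : (ρ b : Matrix (Fin 2) (Fin 2) ℂ) = !![0, (s : ℂ); -(s : ℂ), (s : ℂ)])
    {w : G} (hw : w ∈ Submonoid.closure {a * b, a * b ^ 2}) :
    ∃ c p q r t : ℝ, c ≠ 0 ∧ 0 < p ∧ 0 ≤ q ∧ 0 ≤ r ∧ 0 < t ∧ (w = 1 ∨ 0 < q + r) ∧
      (ρ w : Matrix (Fin 2) (Fin 2) ℂ) =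
        !![(c * p : ℂ), -(c * q : ℂ); -(c * r : ℂ), (c * t : ℂ)] := by
  induction hw using Submonoid.closure_induction_left with
  | one => exact ⟨1, 1, 0, 0, 1, by simp [Matrix.one_fin_two]⟩
  | mul_left x hx w _ ih =>
    obtain ⟨c, p, q, r, t, hc, hp, hq, hr, ht, -, hρ⟩ := ih
    obtain rfl | rfl := hx
    · refine ⟨-s ^ 2 * c, p + r, q + t, s * r, s * t, by simp [hs.ne', hc], by positivity,
        by positivity, by positivity, by positivity, Or.inr (by positivity), ?_⟩
      simp only [map_mul, Units.val_mul, ha, hb, hρ, Matrix.mul_fin_two]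
      push_cast
      ext i j
      fin_cases i <;> fin_cases j <;> simp <;> ring
    · refine ⟨-s ^ 3 * c, p, q, s * (p + r), s * (q + t), by simp [hs.ne', hc], by positivity,
        by positivity, by positivity, by positivity, Or.inr (by positivity), ?_⟩
      simp only [map_mul, Units.val_mul, ha, hb, hρ, pow_two,
        Matrix.mul_fin_two]
      push_cast
      ext i j
      fin_cases i <;> fin_cases j <;> simp <;> ring

/-- The only elements `b ^ i * w * a ^ j`, with `w` a positive word in `a * b` and `a * b ^ 2`,
represented by a diagonal matrix are the trivial ones. -/
theorem eq_one_of_diagonal {G : Type*} [Group G] (ρ : G →* GL (Fin 2) ℂ) {a b : G} {s : ℝ}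
    (hs : 0 < s) (ha : (ρ a : Matrix (Fin 2) (Fin 2) ℂ) = !![0, (s : ℂ); -(s : ℂ) ^ 2, 0])
    (hb : (ρ b : Matrix (Fin 2) (Fin 2) ℂ) = !![0, (s : ℂ); -(s : ℂ), (s : ℂ)])
    {w : G} (hw : w ∈ Submonoid.closure {a * b, a * b ^ 2}) {i j : ℕ} (hi : i < 3) (hj : j < 2)
    (h₀₁ : (ρ (b ^ i * w * a ^ j) : Matrix (Fin 2) (Fin 2) ℂ) 0 1 = 0)
    (h₁₀ : (ρ (b ^ i * w * a ^ j) : Matrix (Fin 2) (Fin 2) ℂ) 1 0 = 0) :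
    b ^ i * w * a ^ j = 1 := by
  obtain ⟨c, p, q, r, t, hc, hp, hq, hr, ht, hqr, hρ⟩ := exists_sign_pattern ρ hs ha hb hw
  have hqt : s * (c * (q + t)) ≠ 0 := by positivity
  have hpr : s * (s * (c * (p + r))) ≠ 0 := by positivity
  have hs' := hs.ne'
  have hp' := hp.ne'
  have ht' := ht.ne'
  simp only [map_mul, map_pow, Units.val_mul, Units.val_pow_eq_pow_val, ha, hb, hρ] at h₀₁ h₁₀
  interval_cases i <;> interval_cases j <;>
    simp [pow_two, Matrix.mul_apply, Fin.sum_univ_two] at h₀₁ h₁₀ <;> norm_cast at h₀₁ h₁₀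
  · obtain rfl | h := hqr
    · simp
    · simp_all
  · simp_all
  · simp_all
  · exact absurd (by linear_combination h₁₀.resolve_right hs') hqt
  · simp_all
  · exact absurd (by linear_combination -h₀₁.resolve_right hs') hpr

/-- **Negative real specializations (Scherich).** For every real t₀ < 0 with t₀ ≠ -1,
the specialized Burau representation ρ₃^{t₀} : B₃ → GL(2, ℂ) is faithful. -/
theorem burau_faithful_neg_real (t₀ : ℝ) (hneg : t₀ < 0) (hne : t₀ ≠ -1)
    (ρ : B3 →* GL (Fin 2) ℂ)
    (hρ₁ : (ρ σ₁ : Matrix (Fin 2) (Fin 2) ℂ) = !![-(t₀ : ℂ), 1; 0, 1])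
    (hρ₂ : (ρ σ₂ : Matrix (Fin 2) (Fin 2) ℂ) = !![(1 : ℂ), 0; (t₀ : ℂ), -(t₀ : ℂ)]) :
    Function.Injective ρ := by
  obtain ⟨s, rfl⟩ : ∃ s, t₀ = -s := ⟨-t₀, by simp⟩
  have hs : 0 < s := by linarith
  have hs1 : s ≠ 1 := by rintro rfl; exact hne rfl
  have hb : (ρ (σ₁ * σ₂) : Matrix (Fin 2) (Fin 2) ℂ) = !![0, (s : ℂ); -(s : ℂ), (s : ℂ)] := by
    simp [hρ₁, hρ₂]
  have ha : (ρ (σ₁ * σ₂ * σ₁) : Matrix (Fin 2) (Fin 2) ℂ) =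
      !![0, (s : ℂ); -(s : ℂ) ^ 2, 0] := by
    rw [map_mul, Units.val_mul, hb, hρ₁]
    simp [pow_two]
  have hs3 : -(s : ℂ) ^ 3 ≠ 0 := by simp [hs.ne']
  have hz : ρ ((σ₁ * σ₂ * σ₁) ^ 2) =
      Matrix.GeneralLinearGroup.scalar (Fin 2) (Units.mk0 (-(s : ℂ) ^ 3) hs3) := by
    ext i j
    rw [map_pow, Units.val_pow_eq_pow_val, ha]
    fin_cases i <;> fin_cases j <;> simp [pow_succ, mul_assoc]
  rw [injective_iff_map_eq_one]
  intro g hg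
  obtain ⟨k, i, hi, j, hj, w, hw, rfl⟩ := exists_normal_form_s15 half_twist_sq closure_half_twist g
  have hinv : ρ ((σ₁ * σ₂) ^ i * w * (σ₁ * σ₂ * σ₁) ^ j) =
      Matrix.GeneralLinearGroup.scalar (Fin 2) (Units.mk0 (-(s : ℂ) ^ 3) hs3 ^ (-k)) := by
    rw [map_mul, map_zpow, hz] at hg
    rw [map_zpow, _root_.zpow_neg]
    exact eq_inv_of_mul_eq_one_right hg
  have h1 := eq_one_of_diagonal ρ hs ha hb hw hi hj (by rw [hinv]; simp [-map_zpow, -_root_.zpow_neg])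
    (by rw [hinv]; simp [-map_zpow, -_root_.zpow_neg])
  rw [h1, map_one] at hinv
  have hk : (1 : ℂ) = (-(s : ℂ) ^ 3) ^ (-k) := by
    simpa [-map_zpow, -_root_.zpow_neg] using congr_arg (fun M : GL (Fin 2) ℂ => (M : Matrix (Fin 2) (Fin 2) ℂ) 0 0) hinv
  have hk' : (s ^ 3) ^ (-k) = 1 := by
    simpa [abs_of_pos hs] using (congr_arg norm hk).symm
  have hk0 : k = 0 := by
    have h3 : s ^ 3 ≠ 1 := by simpa [pow_eq_one_iff_of_nonneg hs.le] using hs1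
    simpa [zpow_eq_one_iff_right₀ (pow_pos hs 3).le h3] using hk'
  rw [h1, hk0, zpow_zero, mul_one]
end
end
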